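/- Let S = k[x_1,...,x_n] and 1 ≤ h < n, and let ≼_h be the preorder on monomials of S determined by the (n−h) × n matrix Ω_h whose i-th row (for i = 1,...,n−h) has entry 1 in columns 1 through n − i and entry 0 in columns n − i + 1 through n. Let f_1,...,f_h ∈ S be homogeneous polynomials such that f_1,...,f_h, x_{h+1},...,x_n is a regular sequence in S. Then in_h((f_1,...,f_h, x_{h+1},...,x_n)) = (in_h(f_1),...,in_h(f_h), x_{h+1},...,x_n). In particular, f_1,...,f_h form a Gröbner basis of (f_1,...,f_h) with respect to ≼_h, and in_h(f_1),...,in_h(f_h) form a homogeneous regular sequence in S̄ = k[x_1,...,x_h]. -/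

import Mathlib

open MvPolynomial

noncomputable section

/-- Lexicographic comparison of weight vectors in `Fin N → ℕ`. -/
def lexLE {N : ℕ} (a b : Fin N → ℕ) : Prop :=
  a = b ∨ ∃ r : Fin N, (∀ s : Fin N, s < r → a s = b s) ∧ a r < b r

/-- The vector of weights of a monomial `u` with respect to the rows of the matrix `Ω_h`:
the `r`-th row (for `r = 0,…,n-h-1`, i.e. row `r+1` of `Ω_h`) has entry `1` in the first
`n - (r+1)` columns and `0` afterwards. -/
def omegaKey (n h : ℕ) (u : Fin n →₀ ℕ) : Fin (n - h) → ℕ := fun r =>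
  ∑ i ∈ Finset.univ.filter (fun i : Fin n => (i : ℕ) < n - ((r : ℕ) + 1)), u i

/-- The initial form of `f` with respect to the matrix preorder `≼_h` induced by `Ω_h`:
the sum, with coefficients, of the monomials of `f` of maximal weight vector
(compared lexicographically). -/
def inH {k : Type} [Field k] (n h : ℕ) (f : MvPolynomial (Fin n) k) :
    MvPolynomial (Fin n) k := by
  classical
  exact ∑ m ∈ f.support.filter
      (fun m => ∀ m' ∈ f.support, lexLE (omegaKey n h m') (omegaKey n h m)),
    monomial m (coeff m f)

/-- The initial ideal of `I` with respect to `≼_h`. -/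
def inHIdeal {k : Type} [Field k] (n h : ℕ) (I : Ideal (MvPolynomial (Fin n) k)) :
    Ideal (MvPolynomial (Fin n) k) :=
  Ideal.span (inH n h '' (I : Set (MvPolynomial (Fin n) k)))


section helpers

set_option linter.unusedSectionVars false

/-- `l` is a weakly regular sequence modulo the ideal `I`. -/
def WR {R : Type} [CommRing R] : Ideal R → List R → Prop
  | _, [] => True
  | I, a :: l => (∀ u, a * u ∈ I → u ∈ I) ∧ WR (I ⊔ Ideal.span {a}) l

lemma wr_iff_index {R : Type} [CommRing R] (l : List R) : ∀ (I : Ideal R),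
    WR I l ↔ ∀ i (hi : i < l.length), ∀ u, l[i] * u ∈ I ⊔ Ideal.ofList (l.take i) →
      u ∈ I ⊔ Ideal.ofList (l.take i) := by
  induction l with
  | nil => intro I; simp [WR]
  | cons a l ih =>
    intro I
    rw [WR, ih]
    constructor
    · rintro ⟨h1, h2⟩ i hi u hu
      cases i with
      | zero => simpa using h1 u (by simpa using hu)
      | succ i =>
        simp only [List.take_succ_cons, Ideal.ofList_cons, ← sup_assoc,
          List.getElem_cons_succ] at hu ⊢
        exact h2 i (by simpa using hi) u hu
    · intro H
      refine ⟨fun u hu => ?_, fun i hi u hu => ?_⟩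
      · simpa using H 0 (by simp) u (by simpa using hu)
      · have := H (i+1) (by simpa using hi) u
        simp only [List.take_succ_cons, Ideal.ofList_cons, ← sup_assoc,
          List.getElem_cons_succ] at this
        exact this hu

lemma isWeaklyRegular_iff_wr {R : Type} [CommRing R] (l : List R) :
    RingTheory.Sequence.IsWeaklyRegular R l ↔ WR (⊥ : Ideal R) l := by
  rw [wr_iff_index, RingTheory.Sequence.isWeaklyRegular_iff]
  refine forall₂_congr fun i hi => ?_
  rw [isSMulRegular_iff_right_eq_zero_of_smul, (Submodule.mkQ_surjective _).forall]
  refine forall_congr' fun u => ?_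
  rw [Submodule.mkQ_apply, ← Submodule.Quotient.mk_smul]
  simp only [Submodule.Quotient.mk_eq_zero, smul_eq_mul, Ideal.mul_top, bot_sup_eq]

lemma wr_append {R : Type} [CommRing R] (l l' : List R) : ∀ (I : Ideal R),
    WR I (l ++ l') ↔ WR I l ∧ WR (I ⊔ Ideal.ofList l) l' := by
  induction l with
  | nil => intro I; simp [WR]
  | cons a l ih =>
    intro I
    rw [List.cons_append, WR, WR, ih, Ideal.ofList_cons, sup_assoc, and_assoc]

/-- Changing the members of the list modulo `I`. -/
lemma wr_congr {R : Type} [CommRing R] (L : List (R × R)) : ∀ (I : Ideal R),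
    (∀ p ∈ L, p.1 - p.2 ∈ I) → WR I (L.map Prod.fst) → WR I (L.map Prod.snd) := by
  induction L with
  | nil => intro I _ _; trivial
  | cons p L ih =>
    intro I hI h
    simp only [List.map_cons, WR] at h ⊢
    have hp : p.1 - p.2 ∈ I := hI p (by simp)
    refine ⟨fun u hu => h.1 u ?_, ?_⟩
    · have : p.1 * u = p.2 * u + u * (p.1 - p.2) := by ring
      rw [this]; exact I.add_mem hu (I.mul_mem_left _ hp)
    · have e : I ⊔ Ideal.span {p.2} = I ⊔ Ideal.span {p.1} := by
        apply le_antisymm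
        · refine sup_le le_sup_left ?_
          rw [Ideal.span_singleton_le_iff_mem]
          have : p.2 = p.1 - (p.1 - p.2) := by ring
          rw [this]
          exact Ideal.sub_mem _ (Ideal.mem_sup_right (Ideal.mem_span_singleton_self _))
            (Ideal.mem_sup_left hp)
        · refine sup_le le_sup_left ?_
          rw [Ideal.span_singleton_le_iff_mem]
          have : p.1 = p.2 + (p.1 - p.2) := by ring
          rw [this]
          exact Ideal.add_mem _ (Ideal.mem_sup_right (Ideal.mem_span_singleton_self _))
            (Ideal.mem_sup_left hp)
      rw [e]
      exact ih _ (fun q hq => Ideal.mem_sup_left (hI q (by simp [hq]))) h.2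

/-- Descent of weak regularity along a ring map with a retraction. -/
lemma wr_of_map {R S : Type} [CommRing R] [CommRing S] (φ : R →+* S) (ψ : S →+* R)
    (hψ : ∀ x, ψ (φ x) = x) (l : List R) : ∀ (I : Ideal R),
    WR (I.map φ) (l.map φ) → WR I l := by
  induction l with
  | nil => intro I _; trivial
  | cons a l ih =>
    intro I h
    simp only [List.map_cons, WR] at h ⊢
    refine ⟨fun u hu => ?_, ih _ ?_⟩
    · have h1 := h.1 (φ u) (by rw [← map_mul]; exact Ideal.mem_map_of_mem _ hu)
      have h2 := Ideal.mem_map_of_mem ψ h1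
      rw [hψ, Ideal.map_map] at h2
      have : ψ.comp φ = RingHom.id R := RingHom.ext hψ
      rwa [this, Ideal.map_id] at h2
    · rw [Ideal.map_sup, Ideal.map_span, Set.image_singleton]
      exact h.2

section weights

variable {σ k M : Type} [Field k] [AddCancelCommMonoid M] (w : σ → M)

lemma comp_mul_add {m : M} {f : MvPolynomial σ k} (hf : IsWeightedHomogeneous w f m)
    (b : MvPolynomial σ k) (v : M) :
    weightedHomogeneousComponent w (v + m) (b * f) =
      weightedHomogeneousComponent w v b * f := by
  classical
  ext d
  rw [coeff_weightedHomogeneousComponent, coeff_mul, coeff_mul]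
  split_ifs with h
  · refine Finset.sum_congr rfl fun x hx => ?_
    rw [coeff_weightedHomogeneousComponent]
    split_ifs with h'
    · rfl
    · by_cases hc : coeff x.2 f = 0
      · simp [hc]
      · have := hf hc
        rw [Finset.HasAntidiagonal.mem_antidiagonal] at hx
        rw [← hx, map_add, this] at h
        exact absurd (add_right_cancel h) h'
  · symm
    refine Finset.sum_eq_zero fun x hx => ?_
    rw [coeff_weightedHomogeneousComponent]
    split_ifs with h'
    · by_cases hc : coeff x.2 f = 0
      · simp [hc]
      · have := hf hc
        rw [Finset.HasAntidiagonal.mem_antidiagonal] at hx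
        rw [← hx, map_add, this, h'] at h
        exact absurd rfl h
    · simp

lemma comp_mul_none {m : M} {f : MvPolynomial σ k} (hf : IsWeightedHomogeneous w f m)
    (b : MvPolynomial σ k) (d : M) (hd : ∀ v, v + m ≠ d) :
    weightedHomogeneousComponent w d (b * f) = 0 := by
  classical
  ext e
  rw [coeff_weightedHomogeneousComponent, coeff_mul, coeff_zero]
  split_ifs with h
  · refine Finset.sum_eq_zero fun x hx => ?_
    by_cases hc : coeff x.2 f = 0
    · simp [hc]
    · have := hf hc
      rw [Finset.HasAntidiagonal.mem_antidiagonal] at hx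
      rw [← hx, map_add, this] at h
      exact absurd h (hd _)
  · rfl

/-- Ideals closed under taking weighted homogeneous components. -/
def HomI (I : Ideal (MvPolynomial σ k)) : Prop :=
  ∀ u ∈ I, ∀ d, weightedHomogeneousComponent w d u ∈ I

lemma homI_bot : HomI w (⊥ : Ideal (MvPolynomial σ k)) := by
  intro u hu d
  rw [Ideal.mem_bot] at hu ⊢
  rw [hu, map_zero]

lemma homI_sup {I : Ideal (MvPolynomial σ k)} (hI : HomI w I) {m : M} {f : MvPolynomial σ k}
    (hf : IsWeightedHomogeneous w f m) : HomI w (I ⊔ Ideal.span {f}) := by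
  intro u hu d
  obtain ⟨i, hi, j, hj, rfl⟩ := Submodule.mem_sup.1 hu
  obtain ⟨b, rfl⟩ := Ideal.mem_span_singleton'.1 hj
  rw [map_add]
  refine Ideal.add_mem _ (Ideal.mem_sup_left (hI i hi d)) (Ideal.mem_sup_right ?_)
  by_cases h : ∃ v, v + m = d
  · obtain ⟨v, rfl⟩ := h
    rw [comp_mul_add w hf]
    exact Ideal.mul_mem_left _ _ (Ideal.mem_span_singleton_self _)
  · push Not at h
    rw [comp_mul_none w hf b d h]
    exact Ideal.zero_mem _

lemma homI_ofList (l : List (MvPolynomial σ k)) :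
    ∀ I : Ideal (MvPolynomial σ k), HomI w I → (∀ a ∈ l, ∃ m, IsWeightedHomogeneous w a m) →
    HomI w (I ⊔ Ideal.ofList l) := by
  induction l with
  | nil => intro I hI _; simpa using hI
  | cons a l ih =>
    intro I hI h
    rw [Ideal.ofList_cons, ← sup_assoc]
    obtain ⟨m, hm⟩ := h a (by simp)
    exact ih _ (homI_sup w hI hm) (fun b hb => h b (by simp [hb]))

end weights

section perm

variable {σ k : Type} [Field k]

/-- Homogeneous of positive degree. -/
def PosHom (a : MvPolynomial σ k) : Prop := ∃ d, 0 < d ∧ a.IsHomogeneous d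

lemma mem_of_forall_pow {I : Ideal (MvPolynomial σ k)} (hI : HomI (1 : σ → ℕ) I)
    {a : MvPolynomial σ k} (ha : PosHom a) (u : MvPolynomial σ k)
    (hu : ∀ r : ℕ, ∃ i ∈ I, ∃ v, u = i + v * a ^ r) : u ∈ I := by
  obtain ⟨e, he, ha⟩ := ha
  rw [← sum_homogeneousComponent u]
  refine Ideal.sum_mem _ fun d _ => ?_
  obtain ⟨i, hi, v, h⟩ := hu (d + 1)
  have hp : IsWeightedHomogeneous (1 : σ → ℕ) (a ^ (d + 1)) (e * (d + 1)) := ha.pow _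
  have : homogeneousComponent d u = homogeneousComponent d i := by
    rw [h, map_add]
    have : homogeneousComponent d (v * a ^ (d + 1)) = 0 := by
      apply comp_mul_none (1 : σ → ℕ) hp
      intro v
      have : 1 * (d + 1) ≤ e * (d + 1) := Nat.mul_le_mul_right _ he
      omega
    rw [this, add_zero]
  rw [this]
  exact hI i hi d

lemma wr_perm {l l' : List (MvPolynomial σ k)} (h : l.Perm l') :
    ∀ (I : Ideal (MvPolynomial σ k)), HomI (1 : σ → ℕ) I → (∀ a ∈ l, PosHom a) →
      WR I l → WR I l' := by
  induction h with
  | nil => intro I _ _ h; exact h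
  | cons a _ ih =>
    intro I hI hl h
    obtain ⟨d, hd, ha⟩ := hl a (by simp)
    exact ⟨h.1, ih _ (homI_sup _ hI ha) (fun b hb => hl b (by simp [hb])) h.2⟩
  | trans h1 _ ih1 ih2 =>
    intro I hI hl h
    exact ih2 I hI (fun a ha => hl a (h1.mem_iff.2 ha)) (ih1 I hI hl h)
  | swap a b l =>
    intro I hI hl h
    obtain ⟨hb, ha, h⟩ := h
    refine ⟨?_, ?_, ?_⟩
    · intro u hu
      refine mem_of_forall_pow hI (hl b (by simp)) u fun r => ?_
      suffices H : ∃ i ∈ I, ∃ v, a * v ∈ I ∧ u = i + v * b ^ r by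
        obtain ⟨i, hi, v, -, h⟩ := H
        exact ⟨i, hi, v, h⟩
      induction r with
      | zero => exact ⟨0, I.zero_mem, u, hu, by simp⟩
      | succ r ih =>
        obtain ⟨i, hi, v, hv, rfl⟩ := ih
        have := ha v (Ideal.mem_sup_left hv)
        obtain ⟨j, hj, t, ht, rfl⟩ := Submodule.mem_sup.1 this
        obtain ⟨c, rfl⟩ := Ideal.mem_span_singleton'.1 ht
        refine ⟨i + b ^ r * j, I.add_mem hi (I.mul_mem_left _ hj), c, hb _ ?_, by ring⟩
        have e : b * (a * c) = a * (j + c * b) - a * j := by ring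
        rw [e]
        exact I.sub_mem hv (I.mul_mem_left _ hj)
    · intro u hu
      obtain ⟨j, hj, t, ht, e⟩ := Submodule.mem_sup.1 hu
      obtain ⟨v, hvt⟩ := Ideal.mem_span_singleton'.1 ht
      subst hvt
      have : v ∈ I ⊔ Ideal.span {b} := by
        apply ha
        have e' : a * v = u * b - j := by rw [mul_comm u b, ← e]; ring
        rw [e']
        exact Ideal.sub_mem _ (Ideal.mem_sup_right
          (Ideal.mul_mem_left _ _ (Ideal.mem_span_singleton_self _))) (Ideal.mem_sup_left hj)
      obtain ⟨i', hi', t', ht', rfl⟩ := Submodule.mem_sup.1 this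
      obtain ⟨c, rfl⟩ := Ideal.mem_span_singleton'.1 ht'
      have h2 : u - c * a ∈ I := by
        apply hb
        have e' : b * (u - c * a) = j + a * i' := by
          rw [mul_sub, ← e]; ring
        rw [e']
        exact I.add_mem hj (I.mul_mem_left _ hi')
      have e' : u = (u - c * a) + c * a := by ring
      rw [e']
      exact Ideal.add_mem _ (Ideal.mem_sup_left h2) (Ideal.mem_sup_right
          (Ideal.mul_mem_left _ _ (Ideal.mem_span_singleton_self _)))
    · rwa [sup_assoc, sup_comm (Ideal.span {a}), ← sup_assoc]

end perm

section groebner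

variable {σ k Γ : Type} [Field k] [AddCancelCommMonoid Γ] [LinearOrder Γ]
  [IsOrderedCancelAddMonoid Γ] (w : σ → Γ)

/-- All monomials of `f` have weight at most `v`. -/
def FLe (v : Γ) (f : MvPolynomial σ k) : Prop :=
  ∀ d, coeff d f ≠ 0 → Finsupp.weight w d ≤ v

lemma FLe.add {v : Γ} {f g : MvPolynomial σ k} (hf : FLe w v f) (hg : FLe w v g) :
    FLe w v (f + g) := by
  intro d hd
  rw [coeff_add] at hd
  by_cases h : coeff d f = 0
  · exact hg d (by simpa [h] using hd)
  · exact hf d h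

lemma FLe.sub {v : Γ} {f g : MvPolynomial σ k} (hf : FLe w v f) (hg : FLe w v g) :
    FLe w v (f - g) := by
  intro d hd
  rw [coeff_sub] at hd
  by_cases h : coeff d f = 0
  · exact hg d (by simpa [h] using hd)
  · exact hf d h

lemma FLe.mono {v v' : Γ} {f : MvPolynomial σ k} (hf : FLe w v f) (h : v ≤ v') :
    FLe w v' f := fun d hd => (hf d hd).trans h

lemma FLe.mul {v v' : Γ} {f g : MvPolynomial σ k} (hf : FLe w v f) (hg : FLe w v' g) :
    FLe w (v + v') (f * g) := by
  classical
  intro d hd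
  rw [coeff_mul] at hd
  obtain ⟨x, hx, hne⟩ := Finset.exists_ne_zero_of_sum_ne_zero hd
  rw [Finset.HasAntidiagonal.mem_antidiagonal] at hx
  rw [← hx, map_add]
  exact add_le_add (hf _ (left_ne_zero_of_mul hne)) (hg _ (right_ne_zero_of_mul hne))

lemma FLe.comp_eq_zero {v v' : Γ} {f : MvPolynomial σ k} (hf : FLe w v f) (h : v < v') :
    weightedHomogeneousComponent w v' f = 0 := by
  classical
  ext d
  rw [coeff_weightedHomogeneousComponent, coeff_zero]
  split_ifs with hd
  · by_contra hc
    exact absurd (hf d hc) (by rw [hd]; exact not_le.2 h)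
  · rfl

lemma FLe.comp_mul {v v' : Γ} {f g : MvPolynomial σ k} (hf : FLe w v f) (hg : FLe w v' g) :
    weightedHomogeneousComponent w (v + v') (f * g) =
      weightedHomogeneousComponent w v f * weightedHomogeneousComponent w v' g := by
  classical
  rw [← comp_mul_add w (weightedHomogeneousComponent_isWeightedHomogeneous _ _)]
  ext d
  rw [coeff_weightedHomogeneousComponent, coeff_weightedHomogeneousComponent, coeff_mul, coeff_mul]
  split_ifs with h
  · refine Finset.sum_congr rfl fun x hx => ?_
    rw [coeff_weightedHomogeneousComponent]
    split_ifs with h'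
    · rfl
    · by_cases h1 : coeff x.1 f = 0
      · simp [h1]
      by_cases h2 : coeff x.2 g = 0
      · simp [h2]
      exfalso
      rw [Finset.HasAntidiagonal.mem_antidiagonal] at hx
      rw [← hx, map_add] at h
      have := add_lt_add_of_le_of_lt (hf _ h1) (lt_of_le_of_ne (hg _ h2) h')
      exact absurd h this.ne
  · rfl

lemma FLe.of_hom {v : Γ} {f : MvPolynomial σ k} (hf : IsWeightedHomogeneous w f v) :
    FLe w v f := fun _ hd => (hf hd).le

lemma exists_max {f : MvPolynomial σ k} (hf : f ≠ 0) :
    ∃ d, coeff d f ≠ 0 ∧ FLe w (Finsupp.weight w d) f := by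
  obtain ⟨d, hd, hm⟩ := f.support.exists_max_image (Finsupp.weight w)
    (support_nonempty.2 hf)
  exact ⟨d, mem_support_iff.1 hd, fun e he => hm e (mem_support_iff.2 he)⟩

/-- Initial parts of elements of `I` lie in `J`. -/
def QI (I J : Ideal (MvPolynomial σ k)) : Prop :=
  ∀ v, ∀ g ∈ I, FLe w v g → weightedHomogeneousComponent w v g ∈ J

/-- Homogeneous elements of `J` are initial parts of elements of `I`. -/
def RI (I J : Ideal (MvPolynomial σ k)) : Prop :=
  ∀ v, ∀ u ∈ J, IsWeightedHomogeneous w u v →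
    ∃ g ∈ I, FLe w v g ∧ weightedHomogeneousComponent w v g = u

/-- `f` has top part `p` of weight `m`. -/
def TopW (f p : MvPolynomial σ k) : Prop :=
  ∃ m, FLe w m f ∧ weightedHomogeneousComponent w m f = p

lemma RI.sup {I J : Ideal (MvPolynomial σ k)} (hJ : HomI w J) (hR : RI w I J)
    {f p : MvPolynomial σ k} (hT : TopW w f p) :
    RI w (I ⊔ Ideal.span {f}) (J ⊔ Ideal.span {p}) := by
  obtain ⟨m, hf, rfl⟩ := hT
  intro d u hu hud
  obtain ⟨i, hi, t, ht, rfl⟩ := Submodule.mem_sup.1 hu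
  obtain ⟨b, rfl⟩ := Ideal.mem_span_singleton'.1 ht
  have hp : IsWeightedHomogeneous w (weightedHomogeneousComponent w m f) m :=
    weightedHomogeneousComponent_isWeightedHomogeneous _ _
  obtain ⟨g, hg, hgF, hgc⟩ := hR d _ (hJ i hi d)
    (weightedHomogeneousComponent_isWeightedHomogeneous _ _)
  rw [← hud.weightedHomogeneousComponent_same, map_add]
  by_cases h : ∃ v, v + m = d
  · obtain ⟨v, rfl⟩ := h
    rw [comp_mul_add w hp]
    have hb : FLe w v (weightedHomogeneousComponent w v b) :=
      FLe.of_hom w (weightedHomogeneousComponent_isWeightedHomogeneous _ _)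
    refine ⟨g + weightedHomogeneousComponent w v b * f,
      Ideal.add_mem _ (Ideal.mem_sup_left hg) (Ideal.mem_sup_right
          (Ideal.mul_mem_left _ _ (Ideal.mem_span_singleton_self _))),
      hgF.add w (hb.mul w hf), ?_⟩
    rw [map_add, hgc, hb.comp_mul w hf]
    rw [(weightedHomogeneousComponent_isWeightedHomogeneous v b).weightedHomogeneousComponent_same]
  · push Not at h
    rw [comp_mul_none w hp b d h, add_zero]
    exact ⟨g, Ideal.mem_sup_left hg, hgF, hgc⟩

lemma QI.sup [WellFoundedLT Γ] {I J : Ideal (MvPolynomial σ k)}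
    (hQ : QI w I J) (hR : RI w I J)
    {f p : MvPolynomial σ k} (hT : TopW w f p) (hp : ∀ u, p * u ∈ J → u ∈ J) :
    QI w (I ⊔ Ideal.span {f}) (J ⊔ Ideal.span {p}) := by
  obtain ⟨m, hf, rfl⟩ := hT
  intro d g hg hgF
  obtain ⟨i, hi, t, ht, rfl⟩ := Submodule.mem_sup.1 hg
  obtain ⟨a, rfl⟩ := Ideal.mem_span_singleton'.1 ht
  by_cases ha0 : a = 0
  · subst ha0
    rw [zero_mul, add_zero] at hgF ⊢
    exact Ideal.mem_sup_left (hQ d i hi hgF)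
  obtain ⟨v, hv⟩ : ∃ v, FLe w v a := by
    obtain ⟨e, -, he⟩ := exists_max w ha0
    exact ⟨_, he⟩
  clear ha0 ht hg
  induction v using WellFoundedLT.induction generalizing i a with
  | ind v ih =>
    rcases le_or_gt (v + m) d with h | h
    · have haf : FLe w (v + m) (a * f) := hv.mul w hf
      have hiF : FLe w d i := by
        have := hgF.sub w (haf.mono w h)
        rwa [add_sub_cancel_right] at this
      rw [map_add]
      refine Ideal.add_mem _ (Ideal.mem_sup_left (hQ d i hi hiF)) (Ideal.mem_sup_right ?_)
      rcases h.eq_or_lt with h | h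
      · subst h
        rw [hv.comp_mul w hf]
        exact Ideal.mul_mem_left _ _ (Ideal.mem_span_singleton_self _)
      · rw [haf.comp_eq_zero w h]
        exact Ideal.zero_mem _
    · have haf : FLe w (v + m) (a * f) := hv.mul w hf
      have hiF : FLe w (v + m) i := by
        have := (hgF.mono w h.le).sub w haf
        rwa [add_sub_cancel_right] at this
      have h0 := hgF.comp_eq_zero w h
      rw [map_add, hv.comp_mul w hf] at h0
      have h1 := hQ _ i hi hiF
      have h2 : weightedHomogeneousComponent w v a ∈ J := by
        apply hp
        rw [mul_comm, ← neg_eq_of_add_eq_zero_right h0]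
        exact J.neg_mem h1
      obtain ⟨a', ha', haF, hac⟩ := hR v _ h2
        (weightedHomogeneousComponent_isWeightedHomogeneous _ _)
      have e : i + a * f = (i + f * a') + (a - a') * f := by ring
      have hi' : i + f * a' ∈ I := I.add_mem hi (I.mul_mem_left _ ha')
      rw [e] at hgF ⊢
      by_cases hz : a - a' = 0
      · rw [hz, zero_mul, add_zero] at hgF ⊢
        exact Ideal.mem_sup_left (hQ d _ hi' hgF)
      · obtain ⟨x, hx, hxF⟩ := exists_max w hz
        refine ih (Finsupp.weight w x) (lt_of_le_of_ne (hv.sub w haF x hx) ?_) _ hi' _ hgF hxF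
        intro hxv
        apply hx
        classical
        have := congrArg (coeff x) hac
        rw [coeff_weightedHomogeneousComponent, coeff_weightedHomogeneousComponent,
          if_pos hxv, if_pos hxv] at this
        rw [coeff_sub, this, sub_self]

lemma qI_ofList [WellFoundedLT Γ] (L : List (MvPolynomial σ k × MvPolynomial σ k)) :
    ∀ (I J : Ideal (MvPolynomial σ k)), QI w I J → RI w I J → HomI w J →
    (∀ p ∈ L, TopW w p.1 p.2) → WR J (L.map Prod.snd) →
    QI w (I ⊔ Ideal.ofList (L.map Prod.fst)) (J ⊔ Ideal.ofList (L.map Prod.snd)) := by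
  induction L with
  | nil => intro I J hQ _ _ _ _; simpa using hQ
  | cons p L ih =>
    intro I J hQ hR hJ hT hW
    have hTp := hT p (by simp)
    simp only [List.map_cons, Ideal.ofList_cons, ← sup_assoc]
    refine ih _ _ (hQ.sup w hR hTp hW.1) (hR.sup w hJ hTp) ?_
      (fun q hq => hT q (by simp [hq])) hW.2
    obtain ⟨m, -, hm⟩ := hTp
    rw [← hm]
    exact homI_sup w hJ (weightedHomogeneousComponent_isWeightedHomogeneous _ _)

lemma qI_bot : QI w (⊥ : Ideal (MvPolynomial σ k)) ⊥ := by
  intro v g hg _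
  rw [Ideal.mem_bot] at hg ⊢
  rw [hg, map_zero]

lemma rI_bot : RI w (⊥ : Ideal (MvPolynomial σ k)) ⊥ := by
  intro v u hu _
  rw [Ideal.mem_bot] at hu
  subst hu
  exact ⟨0, Ideal.zero_mem _, fun d hd => absurd (coeff_zero d) hd, map_zero _⟩

end groebner

section concrete

variable {k : Type} [Field k]

/-- Weights of the variables for the matrix `Ω_h`. -/
def keyW (n h : ℕ) : Fin n → Lex (Fin (n - h) → ℕ) := fun i =>
  toLex (fun r => if (i : ℕ) < n - ((r : ℕ) + 1) then 1 else 0)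

/-- Evaluation at a coordinate. -/
def evLex {N : ℕ} (r : Fin N) : Lex (Fin N → ℕ) →+ ℕ where
  toFun x := ofLex x r
  map_zero' := rfl
  map_add' _ _ := rfl

lemma weight_keyW (n h : ℕ) (u : Fin n →₀ ℕ) :
    Finsupp.weight (keyW n h) u = toLex (omegaKey n h u) := by
  apply ofLex.injective
  funext r
  change evLex r _ = omegaKey n h u r
  rw [Finsupp.weight_apply, Finsupp.sum_fintype _ _ (by simp), map_sum, omegaKey,
    Finset.sum_filter]
  refine Finset.sum_congr rfl fun i _ => ?_
  rw [map_nsmul]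
  change u i • (if (i : ℕ) < n - ((r : ℕ) + 1) then 1 else 0) = _
  simp

lemma lexLE_iff {N : ℕ} (a b : Fin N → ℕ) : lexLE a b ↔ toLex a ≤ toLex b := by
  rw [le_iff_eq_or_lt]
  exact Iff.rfl

lemma coeff_inH (n h : ℕ) (g : MvPolynomial (Fin n) k) (d : Fin n →₀ ℕ) :
    coeff d (inH n h g) = by
      classical exact if FLe (keyW n h) (Finsupp.weight (keyW n h) d) g then coeff d g else 0 := by
  classical
  rw [inH, coeff_sum]
  simp only [coeff_monomial, Finset.sum_ite_eq', Finset.mem_filter, lexLE_iff, ← weight_keyW,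
    mem_support_iff, FLe]
  by_cases h0 : coeff d g = 0
  · simp [h0]
  · simp only [ne_eq, h0, not_false_eq_true, true_and]
    congr 1

lemma inH_eq {n h : ℕ} {g : MvPolynomial (Fin n) k} {W : Lex (Fin (n - h) → ℕ)}
    (hF : FLe (keyW n h) W g) (h0 : weightedHomogeneousComponent (keyW n h) W g ≠ 0) :
    inH n h g = weightedHomogeneousComponent (keyW n h) W g := by
  classical
  obtain ⟨e, he⟩ := ne_zero_iff.1 h0
  rw [coeff_weightedHomogeneousComponent] at he
  split_ifs at he with heW
  · ext d
    rw [coeff_inH, coeff_weightedHomogeneousComponent]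
    by_cases hd : coeff d g = 0
    · simp [hd]
    · congr 1
      rw [eq_iff_iff]
      constructor
      · intro H
        exact le_antisymm (hF d hd) (heW ▸ H e he)
      · intro H; rw [H]; exact hF
  · exact absurd rfl he

lemma inH_top {n h : ℕ} (g : MvPolynomial (Fin n) k) :
    TopW (keyW n h) g (inH n h g) := by
  classical
  by_cases h0 : g = 0
  · subst h0
    refine ⟨0, fun d hd => absurd (coeff_zero d) hd, ?_⟩
    rw [map_zero]
    ext d
    rw [coeff_inH]
    simp
  · obtain ⟨d, hd, hF⟩ := exists_max (keyW n h) h0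
    refine ⟨_, hF, (inH_eq hF ?_).symm⟩
    refine ne_zero_iff.2 ⟨d, ?_⟩
    rw [coeff_weightedHomogeneousComponent, if_pos rfl]
    exact hd

lemma inH_hom {n h : ℕ} {g : MvPolynomial (Fin n) k} {W : Lex (Fin (n - h) → ℕ)}
    (hg : IsWeightedHomogeneous (keyW n h) g W) : inH n h g = g := by
  by_cases h0 : g = 0
  · subst h0; simp [inH]
  have e := hg.weightedHomogeneousComponent_same
  rw [inH_eq (FLe.of_hom _ hg) (by rwa [e]), e]

/-- Setting the last variables to zero. -/
def phi {n h : ℕ} : MvPolynomial (Fin n) k →ₐ[k] MvPolynomial (Fin h) k :=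
  aeval (fun i => if hi : (i : ℕ) < h then X ⟨i, hi⟩ else 0)

lemma phi_rename {n h : ℕ} (hn : h ≤ n) (x : MvPolynomial (Fin h) k) :
    phi (rename (Fin.castLE hn) x) = x := by
  have : (phi (n := n)).comp (rename (Fin.castLE hn)) = AlgHom.id k (MvPolynomial (Fin h) k) := by
    ext i : 1
    simp [phi]
  exact DFunLike.congr_fun this x

lemma phi_hom {n h d : ℕ} {x : MvPolynomial (Fin n) k} (hx : x.IsHomogeneous d) :
    (phi x : MvPolynomial (Fin h) k).IsHomogeneous d := by
  have := hx.aeval (fun i : Fin n => if hi : (i : ℕ) < h then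
    (X ⟨i, hi⟩ : MvPolynomial (Fin h) k) else 0) (n := 1) (by
      intro i
      by_cases hi : (i : ℕ) < h
      · simp only [hi, dif_pos]; exact isHomogeneous_X _ _
      · simp only [hi, dif_neg, not_false_iff]; exact isHomogeneous_zero _ _ _)
  rwa [one_mul] at this

lemma sub_rename_phi_mem {n h : ℕ} (hn : h ≤ n) (x : MvPolynomial (Fin n) k) :
    x - rename (Fin.castLE hn) (phi x) ∈
      Ideal.span ((X : Fin n → MvPolynomial (Fin n) k) '' {i | h ≤ (i : ℕ)}) := by
  set I := Ideal.span ((X : Fin n → MvPolynomial (Fin n) k) '' {i | h ≤ (i : ℕ)})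
  rw [← Ideal.Quotient.mk_eq_mk_iff_sub_mem]
  have : (Ideal.Quotient.mkₐ k I) =
      (Ideal.Quotient.mkₐ k I).comp ((rename (Fin.castLE hn)).comp phi) := by
    ext i : 1
    by_cases hi : (i : ℕ) < h
    · simp [phi, hi]
    · have : (X i : MvPolynomial (Fin n) k) ∈ I :=
        Ideal.subset_span ⟨i, not_lt.1 hi, rfl⟩
      simpa [phi, hi] using Ideal.Quotient.eq_zero_iff_mem.2 this
  exact DFunLike.congr_fun this x

lemma omegaKey_le {n h : ℕ} (u : Fin n →₀ ℕ) (r : Fin (n - h)) :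
    omegaKey n h u r ≤ u.degree := by
  rw [omegaKey, Finsupp.degree_eq_sum]
  exact Finset.sum_le_sum_of_subset (Finset.filter_subset _ _)

lemma hom_degree {n d : ℕ} {g : MvPolynomial (Fin n) k} (hg : g.IsHomogeneous d)
    {u : Fin n →₀ ℕ} (hu : coeff u g ≠ 0) : u.degree = d := by
  have := hg hu
  rw [← this]
  exact DFunLike.congr_fun Finsupp.degree_eq_weight_one u

lemma fLe_const {n h d : ℕ} {g : MvPolynomial (Fin n) k} (hg : g.IsHomogeneous d) :
    FLe (keyW n h) (toLex (fun _ => d)) g := by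
  intro u hu
  rw [weight_keyW]
  apply Pi.toLex_monotone
  intro r
  exact (omegaKey_le u r).trans (hom_degree hg hu).le

lemma rename_weight {n h d : ℕ} (hn : h ≤ n) {x : MvPolynomial (Fin h) k}
    (hx : x.IsHomogeneous d) :
    IsWeightedHomogeneous (keyW n h) (rename (Fin.castLE hn) x) (toLex (fun _ => d)) := by
  intro u hu
  rw [weight_keyW]
  congr 1
  funext r
  obtain ⟨v, rfl, hv⟩ := coeff_rename_ne_zero _ _ _ hu
  rw [← hom_degree hx hv, ← Finsupp.degree_mapDomain (Fin.castLE hn) v,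
    omegaKey, Finsupp.degree_eq_sum]
  apply Finset.sum_subset (Finset.filter_subset _ _)
  intro i _ hi
  apply Finsupp.mapDomain_of_notMem_range
  rintro ⟨j, rfl⟩
  apply hi
  have := r.2
  have := j.2
  simp only [Finset.mem_filter, Finset.mem_univ, true_and, Fin.val_castLE]
  omega

lemma comp_const {n h d : ℕ} (hn : h < n) {f : MvPolynomial (Fin n) k}
    (hf : f.IsHomogeneous d) :
    weightedHomogeneousComponent (keyW n h) (toLex (fun _ => d)) f =
      rename (Fin.castLE hn.le) (phi f : MvPolynomial (Fin h) k) := by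
  classical
  have h1 := rename_weight hn.le (phi_hom (h := h) hf)
  have hr : f = rename (Fin.castLE hn.le) (phi f : MvPolynomial (Fin h) k) +
    (f - rename (Fin.castLE hn.le) (phi f : MvPolynomial (Fin h) k)) := by ring
  have hm := sub_rename_phi_mem hn.le f
  have hh : (f - rename (Fin.castLE hn.le) (phi f : MvPolynomial (Fin h) k)).IsHomogeneous d :=
    hf.sub (phi_hom hf).rename_isHomogeneous
  set q := f - rename (Fin.castLE hn.le) (phi f : MvPolynomial (Fin h) k)
  rw [mem_ideal_span_X_image] at hm
  conv_lhs => rw [hr]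
  rw [map_add, h1.weightedHomogeneousComponent_same]
  suffices H : weightedHomogeneousComponent (keyW n h) (toLex (fun _ => d)) q = 0 by
    rw [H, add_zero]
  ext u
  rw [coeff_weightedHomogeneousComponent, coeff_zero]
  split_ifs with hu
  · by_contra hc
    obtain ⟨i, hi, hne⟩ := hm u (mem_support_iff.2 hc)
    rw [weight_keyW] at hu
    have h2 := congrFun (toLex.injective hu) ⟨n - h - 1, by omega⟩
    rw [← hom_degree hh hc, omegaKey, Finsupp.degree_eq_sum] at h2
    refine absurd h2 (ne_of_lt (Finset.sum_lt_sum_of_subset (Finset.filter_subset _ _)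
      (Finset.mem_univ i) ?_ (Nat.pos_of_ne_zero hne) (fun _ _ _ => Nat.zero_le _)))
    have : h ≤ (i : ℕ) := hi
    simp only [Finset.mem_filter, Finset.mem_univ, true_and, not_lt]
    omega
  · rfl

lemma ofList_ofFn {R : Type} [CommRing R] {N : ℕ} (g : Fin N → R) :
    Ideal.ofList (List.ofFn g) = Ideal.span (Set.range g) := by
  exact congrArg Ideal.span (Set.ext fun x => List.mem_ofFn' g x)

end concrete

end helpers

/-- **Lemma 2.4.** Let `f_1,…,f_h ∈ S = k[x_1,…,x_n]` be homogeneous polynomials such that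
`f_1,…,f_h,x_{h+1},…,x_n` is a full regular sequence in `S`. Then
`in_h((f_1,…,f_h,x_{h+1},…,x_n)) = (in_h(f_1),…,in_h(f_h),x_{h+1},…,x_n)`. In particular,
`f_1,…,f_h` form a Gröbner basis of `(f_1,…,f_h)` with respect to `≼_h`, and
`in_h(f_1),…,in_h(f_h)` form a homogeneous regular sequence in `S̄ = k[x_1,…,x_h]`. -/
theorem initial_of_complete_intersection
    (k : Type) [Field k] (n h : ℕ) (h1 : 1 ≤ h) (hn : h < n)
    (f : Fin h → MvPolynomial (Fin n) k)
    (hfhom : ∀ l, ∃ d : ℕ, (f l).IsHomogeneous d)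
    (hreg : RingTheory.Sequence.IsRegular (MvPolynomial (Fin n) k)
      (List.ofFn f ++ List.ofFn (fun i : Fin (n - h) =>
        (X (⟨h + (i : ℕ), by have := i.2; omega⟩ : Fin n) : MvPolynomial (Fin n) k)))) :
    inHIdeal n h (Ideal.span (Set.range f ∪
        Set.range (fun i : Fin (n - h) =>
          (X (⟨h + (i : ℕ), by have := i.2; omega⟩ : Fin n) : MvPolynomial (Fin n) k)))) =
      Ideal.span (Set.range (fun l => inH n h (f l)) ∪
        Set.range (fun i : Fin (n - h) =>
          (X (⟨h + (i : ℕ), by have := i.2; omega⟩ : Fin n) : MvPolynomial (Fin n) k))) ∧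
    inHIdeal n h (Ideal.span (Set.range f)) =
      Ideal.span (Set.range (fun l => inH n h (f l))) ∧
    ∃ g : Fin h → MvPolynomial (Fin h) k,
      (∀ l, rename (Fin.castLE hn.le) (g l) = inH n h (f l)) ∧
      (∀ l, ∃ d : ℕ, (g l).IsHomogeneous d) ∧
      RingTheory.Sequence.IsRegular (MvPolynomial (Fin h) k) (List.ofFn g) := by
  
  classical
  set x : Fin (n - h) → MvPolynomial (Fin n) k := fun i : Fin (n - h) =>
        (X (⟨h + (i : ℕ), by have := i.2; omega⟩ : Fin n) : MvPolynomial (Fin n) k) with hx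
  let g : Fin h → MvPolynomial (Fin h) k := fun l => phi (f l)
  let fb : Fin h → MvPolynomial (Fin n) k := fun l => rename (Fin.castLE hn.le) (g l)
  have hxspan : Ideal.span ((X : Fin n → MvPolynomial (Fin n) k) '' {i | h ≤ (i : ℕ)}) =
      Ideal.ofList (List.ofFn x) := by
    rw [ofList_ofFn]
    congr 1
    ext y
    constructor
    · rintro ⟨i, hi, rfl⟩
      have hi' : h ≤ (i : ℕ) := hi
      refine ⟨⟨i - h, by have := i.2; omega⟩, ?_⟩
      simp only [hx]
      congr 1
      ext
      simp only
      omega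
    · rintro ⟨i, rfl⟩
      exact ⟨_, Nat.le_add_right _ _, rfl⟩
  have hsub : ∀ l, f l - fb l ∈ Ideal.ofList (List.ofFn x) := by
    intro l
    rw [← hxspan]
    exact sub_rename_phi_mem hn.le (f l)
  have hJ : Ideal.ofList (List.ofFn f) ⊔ Ideal.ofList (List.ofFn x) =
      Ideal.ofList (List.ofFn fb) ⊔ Ideal.ofList (List.ofFn x) := by
    apply le_antisymm
    · refine sup_le ?_ le_sup_right
      rw [ofList_ofFn f, Ideal.span_le]
      rintro _ ⟨l, rfl⟩
      have e : f l = fb l + (f l - fb l) := by ring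
      rw [e, ofList_ofFn fb]
      exact Ideal.add_mem _ (Ideal.mem_sup_left (Ideal.subset_span ⟨l, rfl⟩))
        (Ideal.mem_sup_right (hsub l))
    · refine sup_le ?_ le_sup_right
      rw [ofList_ofFn fb, Ideal.span_le]
      rintro _ ⟨l, rfl⟩
      have e : fb l = f l - (f l - fb l) := by ring
      rw [e, ofList_ofFn f]
      exact Ideal.sub_mem _ (Ideal.mem_sup_left (Ideal.subset_span ⟨l, rfl⟩))
        (Ideal.mem_sup_right (hsub l))
  have hne : Ideal.ofList (List.ofFn f) ⊔ Ideal.ofList (List.ofFn x) ≠ ⊤ := by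
    have := hreg.top_ne_smul
    rw [smul_eq_mul, Ideal.mul_top, Ideal.ofList_append] at this
    exact this.symm
  have hxpos : ∀ i, PosHom (x i) := fun i => ⟨1, one_pos, isHomogeneous_X _ _⟩
  have hfpos : ∀ l, PosHom (f l) := by
    intro l
    obtain ⟨d, hd⟩ := hfhom l
    rcases Nat.eq_zero_or_pos d with rfl | h0
    · have hC := totalDegree_eq_zero_iff_eq_C.1 ((totalDegree_zero_iff_isHomogeneous _).2 hd)
      by_cases hc : coeff 0 (f l) = 0
      · rw [hc, C_0] at hC
        rw [hC]
        exact ⟨1, one_pos, isHomogeneous_zero _ _ _⟩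
      · exfalso
        apply hne
        have hu : IsUnit (f l) := by
          rw [hC]
          exact (IsUnit.mk0 _ hc).map C
        refine Ideal.eq_top_of_isUnit_mem _ (Ideal.mem_sup_left ?_) hu
        rw [ofList_ofFn]
        exact Ideal.subset_span ⟨l, rfl⟩
    · exact ⟨d, h0, hd⟩
  have hfbpos : ∀ l, PosHom (fb l) := by
    intro l
    obtain ⟨d, h0, hd⟩ := hfpos l
    exact ⟨d, h0, (phi_hom hd).rename_isHomogeneous⟩
  have hpos : ∀ F : Fin h → MvPolynomial (Fin n) k, (∀ l, PosHom (F l)) →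
      ∀ a ∈ List.ofFn F ++ List.ofFn x, PosHom a := by
    intro F hF a ha
    rcases List.mem_append.1 ha with ha | ha
    · obtain ⟨l, rfl⟩ := (List.mem_ofFn' _ _).1 ha
      exact hF l
    · obtain ⟨l, rfl⟩ := (List.mem_ofFn' _ _).1 ha
      exact hxpos l
  have hW0 : WR ⊥ (List.ofFn f ++ List.ofFn x) :=
    (isWeaklyRegular_iff_wr _).1 hreg.toIsWeaklyRegular
  have hW1 := wr_perm List.perm_append_comm _ (homI_bot _) (hpos f hfpos) hW0
  rw [wr_append, bot_sup_eq] at hW1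
  let L : List (MvPolynomial (Fin n) k × MvPolynomial (Fin n) k) :=
    List.ofFn (fun l => (f l, fb l))
  have hL1 : L.map Prod.fst = List.ofFn f := by
    simp only [L, List.map_ofFn]; rfl
  have hL2 : L.map Prod.snd = List.ofFn fb := by
    simp only [L, List.map_ofFn]; rfl
  have hLmem : ∀ p ∈ L, ∃ l, (f l, fb l) = p := fun p hp => (List.mem_ofFn' _ _).1 hp
  have hW2 : WR (Ideal.ofList (List.ofFn x)) (List.ofFn fb) := by
    rw [← hL2]
    apply wr_congr
    · intro p hp
      obtain ⟨l, rfl⟩ := hLmem p hp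
      exact hsub l
    · rw [hL1]; exact hW1.2
  have hW3 : WR ⊥ (List.ofFn x ++ List.ofFn fb) := by
    rw [wr_append, bot_sup_eq]
    exact ⟨hW1.1, hW2⟩
  have hW4 : WR ⊥ (List.ofFn fb ++ List.ofFn x) :=
    wr_perm List.perm_append_comm _ (homI_bot _)
      (fun a ha => hpos fb hfbpos a (List.perm_append_comm.mem_iff.1 ha)) hW3
  have hW5 : WR ⊥ (List.ofFn fb) := ((wr_append _ _ _).1 hW4).1
  have hfb0 : ∀ l, fb l ≠ 0 := by
    intro l hl
    have := (wr_iff_index _ _).1 hW5 l (by simp) 1 (by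
      rw [List.getElem_ofFn, Fin.eta, hl, zero_mul]; exact Ideal.zero_mem _)
    apply hne
    rw [hJ, Ideal.eq_top_iff_one]
    refine Ideal.mem_sup_left ?_
    rw [bot_sup_eq] at this
    exact Ideal.span_mono (fun y hy => List.mem_of_mem_take hy) this
  have hin : ∀ l, inH n h (f l) = fb l := by
    intro l
    obtain ⟨d, hd⟩ := hfhom l
    have hc := comp_const hn hd
    rw [inH_eq (fLe_const hd) (by rw [hc]; exact hfb0 l), hc]
  have hinf : (fun l => inH n h (f l)) = fb := funext hin
  have hxhom : ∀ i, IsWeightedHomogeneous (keyW n h) (x i) _ := fun i =>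
    isWeightedHomogeneous_X k (keyW n h) _
  have hfbhom : ∀ l, ∃ m, IsWeightedHomogeneous (keyW n h) (fb l) m := by
    intro l
    obtain ⟨d, hd⟩ := hfhom l
    exact ⟨_, rename_weight hn.le (phi_hom hd)⟩
  refine ⟨?_, ?_, g, fun l => (hin l).symm, ?_, ?_⟩
  · rw [hinf, Ideal.span_union, Ideal.span_union, ← ofList_ofFn, ← ofList_ofFn, ← ofList_ofFn]
    apply le_antisymm
    · rw [inHIdeal, Ideal.span_le]
      rintro _ ⟨u, hu, rfl⟩
      obtain ⟨W, -, hc⟩ := inH_top (h := h) u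
      rw [← hc]
      rw [hJ] at hu
      have hH : HomI (keyW n h) (Ideal.ofList (List.ofFn fb) ⊔ Ideal.ofList (List.ofFn x)) := by
        rw [← Ideal.ofList_append, ← bot_sup_eq (Ideal.ofList _)]
        refine homI_ofList _ _ _ (homI_bot _) fun a ha => ?_
        rcases List.mem_append.1 ha with ha | ha
        · obtain ⟨l, rfl⟩ := (List.mem_ofFn' _ _).1 ha
          exact hfbhom l
        · obtain ⟨l, rfl⟩ := (List.mem_ofFn' _ _).1 ha
          exact ⟨_, hxhom l⟩
      exact hH u hu W
    · refine sup_le ?_ ?_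
      · rw [ofList_ofFn fb, Ideal.span_le]
        rintro _ ⟨l, rfl⟩
        refine Ideal.subset_span ⟨f l, Ideal.mem_sup_left ?_, hin l⟩
        rw [ofList_ofFn]
        exact Ideal.subset_span ⟨l, rfl⟩
      · conv_lhs => rw [ofList_ofFn x]
        rw [Ideal.span_le]
        rintro _ ⟨l, rfl⟩
        refine Ideal.subset_span ⟨x l, Ideal.mem_sup_right ?_, inH_hom (hxhom l)⟩
        rw [ofList_ofFn]
        exact Ideal.subset_span ⟨l, rfl⟩
  · rw [hinf]
    apply le_antisymm
    · rw [inHIdeal, Ideal.span_le]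
      rintro _ ⟨u, hu, rfl⟩
      obtain ⟨W, hF, hc⟩ := inH_top (h := h) u
      rw [← hc]
      have hQ := qI_ofList (keyW n h) L ⊥ ⊥ (qI_bot _) (rI_bot _) (homI_bot _) (by
        intro p hp
        obtain ⟨l, rfl⟩ := hLmem p hp
        have := inH_top (h := h) (f l)
        rwa [hin l] at this) (by rw [hL2]; exact hW5)
      rw [hL1, hL2, bot_sup_eq, bot_sup_eq, ofList_ofFn, ofList_ofFn] at hQ
      exact hQ W u hu hF
    · rw [Ideal.span_le]
      rintro _ ⟨l, rfl⟩
      exact Ideal.subset_span ⟨f l, Ideal.subset_span ⟨l, rfl⟩, hin l⟩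
  · intro l
    obtain ⟨d, hd⟩ := hfhom l
    exact ⟨d, phi_hom hd⟩
  · have hfbg : List.ofFn fb = (List.ofFn g).map
        (rename (Fin.castLE hn.le) : MvPolynomial (Fin h) k →ₐ[k] MvPolynomial (Fin n) k).toRingHom := by
      rw [List.map_ofFn]; rfl
    refine ⟨(isWeaklyRegular_iff_wr _).2 ?_, ?_⟩
    · refine wr_of_map
        (rename (Fin.castLE hn.le) : MvPolynomial (Fin h) k →ₐ[k] MvPolynomial (Fin n) k).toRingHom
        (phi : MvPolynomial (Fin n) k →ₐ[k] MvPolynomial (Fin h) k).toRingHom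
        (phi_rename hn.le) _ _ ?_
      rw [Ideal.map_bot, ← hfbg]
      exact hW5
    · rw [smul_eq_mul, Ideal.mul_top]
      intro htop
      apply hne
      rw [hJ, hfbg, ← Ideal.map_ofList, ← htop, Ideal.map_top, top_sup_eq]
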